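/- arXiv:2307.09854 — 2 statements merged into one kernel-verified Lean document; each statement's English description precedes it below -/
import Mathlib

section
/- Let n, k be natural numbers and p, λ real numbers with 1 < k < n/2, p ≥ 1, and −1/2 ≤ λ ≤ 0. Put d = C(n,2) and t₀ = ((3k−n)|λ|^p + k|1+λ|^p + (1/2−k)|1+2λ|^p) / (2|λ|^p + 2|1+λ|^p − |1+2λ|^p). Let t₁ ≤ ⌊t₀ + 1/2⌋ be the largest integer such that k − t₁ is a prime power. If 0 < t₁ < k/2, then there exists a finite set S in ℓ_p^d of positive diameter such that S cannot be partitioned into fewer than C(n,k)/C(n,k−t₁−1) parts each of diameter strictly smaller than the diameter of S. -/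
open Finset

theorem sum_powersetCard_choose_card_inter {α : Type*} [DecidableEq α] (A B : Finset α) {r j : ℕ}
    (hj : j ≤ r) :
    ∑ J ∈ A.powersetCard r, (#(B ∩ J)).choose j = (#(A ∩ B)).choose j * (#A - j).choose (r - j) := by
  have h1 : ∀ J ∈ A.powersetCard r, (#(B ∩ J)).choose j =
      ∑ I ∈ (A ∩ B).powersetCard j, if I ⊆ J then 1 else 0 := by
    intro J hJ
    rw [mem_powersetCard] at hJ
    rw [← card_powersetCard, sum_boole]
    simp only [Nat.cast_id]
    congr 1
    ext I
    simp only [mem_powersetCard, mem_filter, subset_inter_iff]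
    constructor
    · rintro ⟨⟨h1, h2⟩, h3⟩; exact ⟨⟨⟨h2.trans hJ.1, h1⟩, h3⟩, h2⟩
    · tauto
  rw [sum_congr rfl h1, sum_comm, ← card_powersetCard, card_eq_sum_ones, sum_mul]
  refine sum_congr rfl fun I hI => ?_
  simp only [mem_powersetCard, subset_inter_iff] at hI
  rw [one_mul, sum_boole]
  simp only [Nat.cast_id]
  rw [← hI.2, ← card_sdiff_of_subset hI.1.1, ← card_powersetCard]
  refine card_bij' (fun J _ => J \ I) (fun J _ => J ∪ I) ?_ ?_ ?_ ?_
  · intro J hJ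
    simp only [mem_filter, mem_powersetCard] at hJ ⊢
    exact ⟨sdiff_subset_sdiff hJ.1.1 subset_rfl, by rw [card_sdiff_of_subset hJ.2, hJ.1.2]⟩
  · intro J hJ
    simp only [mem_filter, mem_powersetCard, subset_sdiff] at hJ ⊢
    refine ⟨⟨union_subset hJ.1.1 hI.1.1, ?_⟩, subset_union_right⟩
    rw [card_union_of_disjoint hJ.1.2, hJ.2]; omega
  · intro J hJ
    simp only [mem_filter] at hJ
    exact sdiff_union_of_subset hJ.2
  · intro J hJ
    simp only [mem_powersetCard, subset_sdiff] at hJ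
    exact union_sdiff_cancel_right hJ.1.2

theorem Nat.Prime.dvd_choose_pow_sub_one {p e N : ℕ} (hp : p.Prime) (h : ¬ p ^ e ∣ N + 1) :
    p ∣ N.choose (p ^ e - 1) := by
  by_contra hd
  have hc : Nat.Coprime (p ^ e) (N.choose (p ^ e - 1)) :=
    Nat.Coprime.pow_left _ ((Nat.Prime.coprime_iff_not_dvd hp).2 hd)
  have h1 := Nat.add_one_mul_choose_eq N (p ^ e - 1)
  rw [Nat.sub_add_cancel (Nat.pos_of_ne_zero (pow_ne_zero _ hp.ne_zero))] at h1
  exact h (hc.dvd_of_dvd_mul_right (h1 ▸ Dvd.intro_left _ rfl))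

theorem Nat.Prime.not_dvd_choose_two_mul_pow_sub_one {p e : ℕ} (hp : p.Prime) :
    ¬ p ∣ (p ^ e + (p ^ e - 1)).choose (p ^ e - 1) := by
  rw [Nat.add_choose_eq, Finset.Nat.sum_antidiagonal_eq_sum_range_succ_mk, sum_range_succ']
  intro h
  have h2 : p ∣ ∑ i ∈ range (p ^ e - 1),
      (p ^ e).choose (i + 1) * (p ^ e - 1).choose (p ^ e - 1 - (i + 1)) := by
    refine dvd_sum fun i hi => Dvd.dvd.mul_right (hp.dvd_choose_pow (by omega) ?_) _
    rw [mem_range] at hi; omega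
  have h3 := (Nat.dvd_add_right h2).1 h
  simp at h3
  exact hp.one_lt.ne' h3

theorem card_le_choose_of_card_inter_ne {α : Type*} [Fintype α] [DecidableEq α] {q t : ℕ}
    (hq : IsPrimePow q) (htq : t < q) (F : Finset (Finset α)) (hF : ∀ A ∈ F, #A = q + t)
    (h : ∀ A ∈ F, ∀ B ∈ F, #(A ∩ B) ≠ t) :
    #F ≤ (Fintype.card α).choose (q - 1) := by
  obtain ⟨p, e, hp, he, rfl⟩ := hq
  replace hp := hp.nat_prime
  set q := p ^ e with hqdef
  have : Fact p.Prime := ⟨hp⟩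
  let M : Matrix F F ℤ := Matrix.of fun B A => ((#(A.1 ∩ B.1) + (q - 1 - t)).choose (q - 1) : ℕ)
  let Y : Matrix F (powersetCard (q - 1) (univ : Finset α)) ℚ := Matrix.of fun B J =>
    ∑ j ∈ range q, ((q - 1 - t).choose (q - 1 - j) : ℚ) * ((#(B.1 ∩ J.1)).choose j : ℚ) /
      ((q + t - j).choose (q - 1 - j) : ℚ)
  let W : Matrix (powersetCard (q - 1) (univ : Finset α)) F ℚ := Matrix.of fun J A =>
    if J.1 ⊆ A.1 then 1 else 0
  have hYW : M.map (Int.castRingHom ℚ) = Y * W := by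
    ext B A
    simp only [Matrix.map_apply, Matrix.mul_apply, Matrix.of_apply, M, Y, W]
    rw [sum_coe_sort (powersetCard (q - 1) (univ : Finset α)) (fun J : Finset α =>
      (∑ j ∈ range q, ((q - 1 - t).choose (q - 1 - j) : ℚ) * ((#(B.1 ∩ J)).choose j : ℚ) /
      ((q + t - j).choose (q - 1 - j) : ℚ)) * if J ⊆ A.1 then 1 else 0)]
    simp only [mul_ite, mul_one, mul_zero]
    rw [← sum_filter]
    have hA : (powersetCard (q - 1) (univ : Finset α)).filter (fun J => J ⊆ A.1) =
        powersetCard (q - 1) A.1 := by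
      ext J; simp [mem_powersetCard, and_comm]
    rw [hA, sum_comm, Nat.add_choose_eq, Finset.Nat.sum_antidiagonal_eq_sum_range_succ_mk,
      Nat.succ_eq_add_one, Nat.sub_add_cancel (by omega : 1 ≤ q), eq_intCast]
    push_cast
    refine sum_congr rfl fun j hj => ?_
    rw [mem_range] at hj
    rw [← sum_div, ← mul_sum, ← Nat.cast_sum,
      sum_powersetCard_choose_card_inter _ _ (by omega : j ≤ q - 1), hF A.1 A.2]
    have : ((q + t - j).choose (q - 1 - j) : ℚ) ≠ 0 := by
      exact_mod_cast (Nat.choose_pos (by omega)).ne'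
    push_cast
    field_simp
  have hmod : M.map (Int.castRingHom (ZMod p)) =
      Matrix.diagonal fun _ => (((q + (q - 1)).choose (q - 1) : ℕ) : ZMod p) := by
    ext B A
    simp only [Matrix.map_apply, Matrix.of_apply, M, eq_intCast, Int.cast_natCast]
    by_cases hAB : B = A
    · subst hAB
      rw [Matrix.diagonal_apply_eq, inter_self, hF _ B.2]
      rw [show q + t + (q - 1 - t) = q + (q - 1) by omega]
    · rw [Matrix.diagonal_apply_ne _ hAB, ZMod.natCast_eq_zero_iff]
      refine hp.dvd_choose_pow_sub_one ?_
      rw [← hqdef]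
      have h1 : #(A.1 ∩ B.1) < q + t := by
        rw [← hF _ A.2]
        refine card_lt_card (inter_subset_left.ssubset_of_ne fun hh => hAB ?_)
        rw [inter_eq_left] at hh
        exact (Subtype.ext (eq_of_subset_of_card_le hh (by rw [hF _ A.2, hF _ B.2]))).symm
      have h2 := h _ A.2 _ B.2
      rintro ⟨c, hc⟩
      have hc1 : c < 2 := by
        by_contra! hh
        have := Nat.mul_le_mul_left q hh
        omega
      interval_cases c <;> omega
  have hdet : M.det ≠ 0 := by
    intro h0
    have h1 := (Int.castRingHom (ZMod p)).map_det M
    rw [RingHom.mapMatrix_apply, hmod, h0, Matrix.det_diagonal, map_zero, prod_const] at h1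
    have h2 := eq_zero_of_pow_eq_zero h1.symm
    rw [ZMod.natCast_eq_zero_iff] at h2
    exact hp.not_dvd_choose_two_mul_pow_sub_one h2
  have hdetQ : IsUnit (Y * W) := by
    rw [Matrix.isUnit_iff_isUnit_det, ← hYW, isUnit_iff_ne_zero, ← RingHom.mapMatrix_apply,
      ← RingHom.map_det]
    simpa using hdet
  have h1 := Matrix.rank_of_isUnit _ hdetQ
  have h2 := (Matrix.rank_mul_le_right Y W).trans W.rank_le_card_height
  rw [h1] at h2
  simpa using h2

theorem sum_sum_eq_two_mul_sum_lt_add_sum_diag {ι : Type*} [Fintype ι] [LinearOrder ι]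
    (h : ι → ι → ℝ) (hs : ∀ i j, h i j = h j i) :
    ∑ i, ∑ j, h i j = 2 * ∑ x : {x : ι × ι // x.1 < x.2}, h x.1.1 x.1.2 + ∑ i, h i i := by
  have h1 : ∑ x : {x : ι × ι // x.1 < x.2}, h x.1.1 x.1.2 =
      ∑ i, ∑ j, if i < j then h i j else 0 := by
    rw [← Fintype.sum_prod_type' (f := fun i j => if i < j then h i j else 0), ← sum_filter]
    exact (sum_subtype (univ.filter fun x : ι × ι => x.1 < x.2) (by simp)
      (fun x : ι × ι => h x.1 x.2)).symm
  have h2 : ∑ i, ∑ j, (if j < i then h i j else 0) = ∑ i, ∑ j, if i < j then h i j else 0 := by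
    rw [sum_comm]
    simp only [hs]
  have h3 : ∑ i, h i i = ∑ i, ∑ j, if i = j then h i j else 0 := by simp
  rw [h1, two_mul, h3]
  nth_rewrite 1 [← h2]
  simp only [← sum_add_distrib]
  refine sum_congr rfl fun i _ => sum_congr rfl fun j _ => ?_
  rcases lt_trichotomy i j with hij | hij | hij
  · simp [hij, hij.not_gt, hij.ne]
  · simp [hij]
  · simp [hij, hij.not_gt, hij.ne']

theorem card_subtype_fst_lt_snd (n : ℕ) :
    Fintype.card {x : Fin n × Fin n // x.1 < x.2} = n.choose 2 := by
  have h := sum_sum_eq_two_mul_sum_lt_add_sum_diag (ι := Fin n) (fun _ _ => 1) (by simp)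
  simp only [sum_const, card_univ, Fintype.card_fin, nsmul_eq_mul, mul_one] at h
  have h2 := Nat.cast_choose_two ℝ n
  have : (Fintype.card {x : Fin n × Fin n // x.1 < x.2} : ℝ) = n.choose 2 := by
    rw [h2]; linarith
  exact_mod_cast this

/-- The coordinate at the pair `i, j` of the point representing the set `A`. -/
noncomputable def pairCoord {ι : Type*} [DecidableEq ι] (lam : ℝ) (A : Finset ι) (i j : ι) : ℝ :=
  (if i ∈ A then 1 else 0) * (if j ∈ A then 1 else 0) +
    lam * ((if i ∈ A then 1 else 0) + (if j ∈ A then 1 else 0))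

theorem sum_abs_pairCoord_sub_rpow {n k : ℕ} {p : ℝ} (hp : 1 ≤ p) (lam : ℝ)
    (A B : Finset (Fin n)) (hA : #A = k) (hB : #B = k) :
    ∑ x : {x : Fin n × Fin n // x.1 < x.2},
        |pairCoord lam A x.1.1 x.1.2 - pairCoord lam B x.1.1 x.1.2| ^ p =
      ((k : ℝ) - #(A ∩ B)) * ((k - #(A ∩ B) - 1) * |1 + 2 * lam| ^ p +
        2 * #(A ∩ B) * |1 + lam| ^ p + 2 * (n - 2 * k + #(A ∩ B)) * |lam| ^ p) := by
  have h0 : (0 : ℝ) ^ p = 0 := Real.zero_rpow (by linarith)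
  have key := sum_sum_eq_two_mul_sum_lt_add_sum_diag (ι := Fin n)
    (fun i j => |pairCoord lam A i j - pairCoord lam B i j| ^ p)
    (by intro i j; simp only [pairCoord]; congr 2; ring)
  let a : Fin n → ℝ := fun i => if i ∈ A then 1 else 0
  let b : Fin n → ℝ := fun i => if i ∈ B then 1 else 0
  let w : Fin n → ℝ := fun i => if i ∈ A ∩ B then 1 else 0
  have e : ∀ i j, |pairCoord lam A i j - pairCoord lam B i j| ^ p =
      |1 + 2 * lam| ^ p * ((a i - w i) * (a j - w j) + (b i - w i) * (b j - w j)) +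
      |1 + lam| ^ p * ((a i + b i - 2 * w i) * w j + w i * (a j + b j - 2 * w j)) +
      |lam| ^ p * ((a i + b i - 2 * w i) * (1 - a j - b j + w j) +
        (1 - a i - b i + w i) * (a j + b j - 2 * w j)) := by
    have e4 : |-1 - lam * 2| = |1 + lam * 2| := by rw [← abs_neg]; congr 1; ring
    have e5 : |-1 - lam| = |1 + lam| := by rw [← abs_neg]; congr 1; ring
    intro i j
    simp only [pairCoord, a, b, w, mem_inter]
    by_cases h1 : i ∈ A <;> by_cases h2 : i ∈ B <;> by_cases h3 : j ∈ A <;>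
      by_cases h4 : j ∈ B <;> simp [h1, h2, h3, h4, h0] <;> ring_nf <;>
      simp [e4, e5]
  have e' : ∀ i, |pairCoord lam A i i - pairCoord lam B i i| ^ p =
      |1 + 2 * lam| ^ p * (a i + b i - 2 * w i) := by
    intro i
    rw [e]
    simp only [a, b, w, mem_inter]
    by_cases h1 : i ∈ A <;> by_cases h2 : i ∈ B <;> simp [h1, h2] <;> ring
  have sa : ∑ i, a i = k := by simp [a, hA]
  have sb : ∑ i, b i = k := by simp [b, hB]
  have sw : ∑ i, w i = #(A ∩ B) := by simp only [w, sum_boole, filter_mem_eq_inter, univ_inter]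
  simp only [e'] at key
  rw [sum_congr rfl fun i _ => sum_congr rfl fun j _ => e i j] at key
  simp only [← mul_sum, ← sum_mul, sum_add_distrib, sum_sub_distrib, sa, sb, sw, sum_const,
    card_univ, Fintype.card_fin, nsmul_eq_mul, mul_one] at key
  linear_combination (-1 / 2) * key

theorem exists_near_critical {n k t : ℕ} {p lam : ℝ} (hp : 1 ≤ p) (hlam₁ : -(1/2) ≤ lam)
    (hlam₂ : lam ≤ 0) (ht : 0 < t)
    (h : (t : ℝ) ≤ ((3 * (k : ℝ) - n) * |lam| ^ p + k * |1 + lam| ^ p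
        + (1/2 - k) * |1 + 2*lam| ^ p)
        / (2 * |lam| ^ p + 2 * |1 + lam| ^ p - |1 + 2*lam| ^ p) + 1 / 2) :
    ∃ μ : ℝ, 0 < |1 + μ| ^ p ∧ 0 < 2 * |μ| ^ p + 2 * |1 + μ| ^ p - |1 + 2*μ| ^ p ∧
      |(3 * (k : ℝ) - n) * |μ| ^ p + k * |1 + μ| ^ p + (1/2 - k) * |1 + 2*μ| ^ p -
        t * (2 * |μ| ^ p + 2 * |1 + μ| ^ p - |1 + 2*μ| ^ p)| ≤
      (2 * |μ| ^ p + 2 * |1 + μ| ^ p - |1 + 2*μ| ^ p) / 2 := by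
  have hp0 : 0 < p := by linarith
  have pos : ∀ μ : ℝ, -(1/2) ≤ μ → μ ≤ 0 → 0 < |1 + μ| ^ p ∧
      0 < 2 * |μ| ^ p + 2 * |1 + μ| ^ p - |1 + 2*μ| ^ p := by
    intro μ h1 h2
    have hB : 0 < |1 + μ| ^ p := Real.rpow_pos_of_pos (abs_pos.2 (by linarith)) p
    have hA : 0 ≤ |μ| ^ p := by positivity
    have hC : |1 + 2 * μ| ^ p ≤ |1 + μ| ^ p := by
      refine Real.rpow_le_rpow (abs_nonneg _) ?_ hp0.le
      rw [abs_of_nonneg (by linarith), abs_of_nonneg (by linarith)]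
      linarith
    exact ⟨hB, by linarith⟩
  obtain ⟨hB, hM⟩ := pos lam hlam₁ hlam₂
  let G : ℝ → ℝ := fun μ => (3 * (k : ℝ) - n) * |μ| ^ p + k * |1 + μ| ^ p +
    (1/2 - k) * |1 + 2*μ| ^ p - t * (2 * |μ| ^ p + 2 * |1 + μ| ^ p - |1 + 2*μ| ^ p)
  rw [← sub_le_iff_le_add, le_div_iff₀ hM] at h
  by_cases hG : 0 ≤ G lam
  · have hc : Continuous G := by
      have c : ∀ f : ℝ → ℝ, Continuous f → Continuous fun μ => |f μ| ^ p := fun f hf =>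
        hf.abs.rpow_const fun _ => Or.inr hp0.le
      have c1 := c (fun μ => μ) (by fun_prop)
      have c2 := c (fun μ => 1 + μ) (by fun_prop)
      have c3 := c (fun μ => 1 + 2 * μ) (by fun_prop)
      fun_prop
    have hG0 : G 0 ≤ 0 := by
      have : (1 : ℝ) ≤ t := by exact_mod_cast ht
      simp [G, Real.zero_rpow hp0.ne']
      linarith
    obtain ⟨μ, hμ, h0⟩ := intermediate_value_Icc' hlam₂ hc.continuousOn ⟨hG0, hG⟩
    obtain ⟨hB', hM'⟩ := pos μ (hlam₁.trans hμ.1) hμ.2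
    refine ⟨μ, hB', hM', ?_⟩
    simp only [G] at h0
    rw [h0, abs_zero]
    linarith
  · refine ⟨lam, hB, hM, ?_⟩
    simp only [G] at hG
    rw [abs_le]
    constructor <;> linarith


/-- **Theorem 1 (Kahn–Kalai for `ℓ_p`-spaces).**
Given `n, k ∈ ℕ` and reals `p, λ` with `1 < k < n/2`, `p ≥ 1`, `−1/2 ≤ λ ≤ 0`, put
`d = C(n,2)` and
`t₀ = ((3k−n)|λ|^p + k|1+λ|^p + (1/2−k)|1+2λ|^p) / (2|λ|^p + 2|1+λ|^p − |1+2λ|^p)`.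
Let `t₁ ≤ ⌊t₀ + 1/2⌋` be the largest integer such that `k − t₁` is a prime power.
If `0 < t₁ < k/2`, then there is a finite set `S ⊆ ℓ_p^d` of positive diameter that cannot be
partitioned into fewer than `C(n,k)/C(n,k−t₁−1)` parts of diameter smaller than that of `S`. -/
theorem borsuk_lp_lower_bound
    (n k : ℕ) (p lam t₀ : ℝ) (t₁ : ℕ)
    (hk : 1 < k) (hkn : 2 * k < n)
    (hp : 1 ≤ p) [Fact (1 ≤ ENNReal.ofReal p)]
    (hlam₁ : -(1/2) ≤ lam) (hlam₂ : lam ≤ 0)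
    (ht₀ : t₀ = ((3 * (k : ℝ) - n) * |lam| ^ p + k * |1 + lam| ^ p
        + (1/2 - k) * |1 + 2*lam| ^ p)
        / (2 * |lam| ^ p + 2 * |1 + lam| ^ p - |1 + 2*lam| ^ p))
    (ht₁le : (t₁ : ℤ) ≤ ⌊t₀ + 1/2⌋)
    (ht₁pp : ∃ m : ℕ, IsPrimePow m ∧ (k : ℤ) - t₁ = m)
    (ht₁max : ∀ t : ℤ, t ≤ ⌊t₀ + 1/2⌋ → (∃ m : ℕ, IsPrimePow m ∧ (k : ℤ) - t = m) → t ≤ t₁)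
    (ht₁pos : 0 < t₁) (ht₁k : 2 * t₁ < k) :
    ∃ S : Set (PiLp (ENNReal.ofReal p) (fun _ : Fin (n.choose 2) => ℝ)),
      S.Finite ∧ 0 < Metric.diam S ∧
      ∀ (m : ℕ) (P : Fin m → Set (PiLp (ENNReal.ofReal p) (fun _ : Fin (n.choose 2) => ℝ))),
        (m : ℝ) < (n.choose k : ℝ) / (n.choose (k - t₁ - 1) : ℝ) →
        S = ⋃ i, P i →
        (∀ i j, i ≠ j → Disjoint (P i) (P j)) →
        ∃ i, Metric.diam S ≤ Metric.diam (P i) := by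
  obtain ⟨q, hq, hkq⟩ := ht₁pp
  have hkq' : k = q + t₁ := by omega
  have hp0 : 0 < p := by linarith
  have hpr : (ENNReal.ofReal p).toReal = p := ENNReal.toReal_ofReal hp0.le
  have hle : (t₁ : ℝ) ≤ t₀ + 1 / 2 := by
    have := Int.le_floor.1 ht₁le
    exact_mod_cast this
  rw [ht₀] at hle
  obtain ⟨μ, hB, hM, hμ⟩ := exists_near_critical hp hlam₁ hlam₂ ht₁pos hle
  let e : Fin (n.choose 2) ≃ {x : Fin n × Fin n // x.1 < x.2} :=
    (Fintype.equivFinOfCardEq (card_subtype_fst_lt_snd n)).symm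
  let φ : Finset (Fin n) → PiLp (ENNReal.ofReal p) (fun _ : Fin (n.choose 2) => ℝ) := fun A =>
    WithLp.toLp _ fun c => pairCoord μ A (e c).1.1 (e c).1.2
  let D : ℝ → ℝ := fun t => (k - t) * ((k - t - 1) * |1 + 2 * μ| ^ p +
    2 * t * |1 + μ| ^ p + 2 * (n - 2 * k + t) * |μ| ^ p)
  have hsum : ∀ A B : Finset (Fin n), #A = k → #B = k →
      ∑ c, dist (φ A c) (φ B c) ^ p = D #(A ∩ B) := by
    intro A B hA hB
    simp only [φ, Real.dist_eq]
    rw [e.sum_comp (fun x => |pairCoord μ A x.1.1 x.1.2 - pairCoord μ B x.1.1 x.1.2| ^ p)]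
    exact sum_abs_pairCoord_sub_rpow hp μ A B hA hB
  have hdist : ∀ A B : Finset (Fin n), #A = k → #B = k →
      dist (φ A) (φ B) = D #(A ∩ B) ^ (1 / p) := by
    intro A B hA hB
    rw [PiLp.dist_eq_sum (by rwa [hpr]), hpr, hsum A B hA hB]
  have hD0 : ∀ A B : Finset (Fin n), #A = k → #B = k → 0 ≤ D #(A ∩ B) := by
    intro A B hA hB
    rw [← hsum A B hA hB]
    positivity
  have hDmax : ∀ t : ℕ, D t ≤ D t₁ := by
    intro t
    rw [abs_le] at hμ
    have key : D t₁ - D t = (t - t₁) *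
        ((t - t₁) * (2 * |μ| ^ p + 2 * |1 + μ| ^ p - |1 + 2 * μ| ^ p) -
          2 * ((3 * (k : ℝ) - n) * |μ| ^ p + k * |1 + μ| ^ p + (1/2 - k) * |1 + 2*μ| ^ p -
        t₁ * (2 * |μ| ^ p + 2 * |1 + μ| ^ p - |1 + 2*μ| ^ p))) := by
      simp only [D]; ring
    rw [← sub_nonneg, key]
    rcases lt_trichotomy t t₁ with h | h | h
    · have h' : (t : ℝ) + 1 ≤ t₁ := by exact_mod_cast h
      exact mul_nonneg_of_nonpos_of_nonpos (by linarith) (by nlinarith)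
    · simp [h]
    · have h' : (t₁ : ℝ) + 1 ≤ t := by exact_mod_cast h
      exact mul_nonneg (by linarith) (by nlinarith)
  have hDpos : 0 < D t₁ := by
    have h1 : (t₁ : ℝ) + 1 ≤ k := by exact_mod_cast (by omega : t₁ + 1 ≤ k)
    have h2 : 2 * (k : ℝ) ≤ n := by exact_mod_cast hkn.le
    have h3 : (0 : ℝ) < t₁ := by exact_mod_cast ht₁pos
    have h4 : 0 ≤ ((k : ℝ) - t₁ - 1) * |1 + 2 * μ| ^ p :=
      mul_nonneg (by linarith) (by positivity)
    have h5 : 0 ≤ 2 * ((n : ℝ) - 2 * k + t₁) * |μ| ^ p :=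
      mul_nonneg (by linarith) (by positivity)
    exact mul_pos (by linarith) (by positivity)
  have hle_max : ∀ A B : Finset (Fin n), #A = k → #B = k →
      dist (φ A) (φ B) ≤ D t₁ ^ (1 / p) := by
    intro A B hA hB
    rw [hdist A B hA hB]
    exact Real.rpow_le_rpow (hD0 A B hA hB) (hDmax _) (by positivity)
  let S := φ '' (powersetCard k (univ : Finset (Fin n)) : Set (Finset (Fin n)))
  have hSfin : S.Finite := (finite_toSet _).image _
  have hmem : ∀ A : Finset (Fin n), #A = k → φ A ∈ S := fun A hA =>
    Set.mem_image_of_mem _ (by simp [hA])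
  have hdiam : Metric.diam S ≤ D t₁ ^ (1 / p) := by
    refine Metric.diam_le_of_forall_dist_le (Real.rpow_nonneg hDpos.le _) ?_
    rintro _ ⟨A, hA, rfl⟩ _ ⟨B, hB, rfl⟩
    simp only [subset_univ, true_and, mem_coe, mem_powersetCard] at hA hB
    exact hle_max A B hA hB
  refine ⟨S, hSfin, ?_, ?_⟩
  · obtain ⟨A, -, hA⟩ := exists_subset_card_eq (s := (univ : Finset (Fin n))) (n := k)
      (by rw [card_univ, Fintype.card_fin]; omega)
    obtain ⟨T, hTA, hT⟩ := exists_subset_card_eq (s := A) (n := t₁) (by omega)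
    obtain ⟨R, hRA, hR⟩ := exists_subset_card_eq (s := Aᶜ) (n := k - t₁)
      (by rw [card_compl, Fintype.card_fin]; omega)
    have hdisj : Disjoint A R := (subset_compl_iff_disjoint_left.1 hRA)
    have hB' : #(T ∪ R) = k := by
      rw [card_union_of_disjoint (hdisj.mono_left hTA)]; omega
    have hAB : #(A ∩ (T ∪ R)) = t₁ := by
      rw [inter_union_distrib_left, disjoint_iff_inter_eq_empty.1 hdisj, union_empty,
        inter_eq_right.2 hTA, hT]
    refine lt_of_lt_of_le ?_
      (Metric.dist_le_diam_of_mem hSfin.isBounded (hmem A hA) (hmem _ hB'))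
    rw [hdist A _ hA hB', hAB]
    exact Real.rpow_pos_of_pos hDpos _
  · intro m P hm hSP _
    by_contra! hcon
    classical
    let F : Fin m → Finset (Finset (Fin n)) := fun i =>
      (powersetCard k univ).filter fun A => φ A ∈ P i
    have hF : ∀ i, #(F i) ≤ n.choose (k - t₁ - 1) := by
      intro i
      have hcard : ∀ A ∈ F i, #A = k := fun A hA => by simpa using (mem_filter.1 hA).1
      have := card_le_choose_of_card_inter_ne hq (t := t₁) (by omega) (F i)
        (fun A hA => (hcard A hA).trans hkq') ?_
      · rw [Fintype.card_fin] at this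
        rwa [show k - t₁ - 1 = q - 1 by omega]
      · intro A hA B hB hAB
        have hPi : Bornology.IsBounded (P i) :=
          hSfin.isBounded.subset (hSP ▸ Set.subset_iUnion P i)
        have h1 := Metric.dist_le_diam_of_mem hPi (mem_filter.1 hA).2 (mem_filter.1 hB).2
        rw [hdist A B (hcard A hA) (hcard B hB), hAB] at h1
        exact (hcon i).not_ge (hdiam.trans h1)
    have hcover : powersetCard k (univ : Finset (Fin n)) ⊆ univ.biUnion F := by
      intro A hA
      have h1 := hmem A (by simpa using hA)
      rw [hSP, Set.mem_iUnion] at h1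
      obtain ⟨i, hi⟩ := h1
      exact mem_biUnion.2 ⟨i, mem_univ _, mem_filter.2 ⟨hA, hi⟩⟩
    have h1 := (card_le_card hcover).trans (card_biUnion_le_card_mul _ _ _ fun i _ => hF i)
    rw [card_powersetCard, card_univ, card_univ, Fintype.card_fin, Fintype.card_fin] at h1
    have hpos : (0 : ℝ) < n.choose (k - t₁ - 1) := by
      exact_mod_cast Nat.choose_pos (by omega)
    rw [lt_div_iff₀ hpos] at hm
    exact absurd h1 (not_le.2 (by exact_mod_cast hm))
end

section
/- For every real p ≥ 2.81, there exists a finite set S in ℓ_p^406 of positive diameter such that S cannot be partitioned into fewer than 422 parts each of diameter strictly smaller than the diameter of S. -/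
theorem choose_four_mod {k : ℕ} (hk : k < 9) (h4 : k ≠ 4) : ((k.choose 4 : ℕ) : ZMod 5) = 0 := by
  interval_cases k <;> first | omega | decide

theorem choose_nine_four_mod : ((Nat.choose 9 4 : ℕ) : ZMod 5) = 1 := by
  decide

theorem card_le_of_forall_inter_ne_four (F : Finset (Finset (Fin 29)))
    (hF : ∀ A ∈ F, A.card = 9)
    (hint : ∀ A ∈ F, ∀ B ∈ F, A ≠ B → (A ∩ B).card ≠ 4) :
    F.card ≤ Nat.choose 29 4 := by
  have : Fact (Nat.Prime 5) := ⟨by norm_num⟩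
  let J := {I : Finset (Fin 29) // I.card = 4}
  let w : F → J → ZMod 5 := fun A I => if I.1 ⊆ A.1 then 1 else 0
  have hw : ∀ A B : F, w A ⬝ᵥ w B = (((A.1 ∩ B.1).card.choose 4 : ℕ) : ZMod 5) := by
    intro A B
    have h1 : w A ⬝ᵥ w B = ∑ I : J, if I.1 ⊆ A.1 ∩ B.1 then (1 : ZMod 5) else 0 := by
      refine Finset.sum_congr rfl fun I _ => ?_
      simp only [w, Finset.subset_inter_iff]
      split_ifs <;> simp_all
    rw [h1, Finset.sum_boole, ← Finset.card_powersetCard]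
    refine congrArg Nat.cast ?_
    refine Finset.card_bij (fun I _ => I.1) ?_ ?_ ?_
    · intro I hI
      simp only [Finset.mem_filter] at hI
      exact Finset.mem_powersetCard.2 ⟨hI.2, I.2⟩
    · intro I _ K _ h
      exact Subtype.ext h
    · intro I hI
      rw [Finset.mem_powersetCard] at hI
      exact ⟨⟨I, hI.2⟩, by simpa using hI.1, rfl⟩
  have hlin : LinearIndependent (ZMod 5) w := by
    rw [Fintype.linearIndependent_iff]
    intro g hg A
    have h2 : (∑ B, g B • w B) ⬝ᵥ w A = 0 := by rw [hg, zero_dotProduct]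
    rw [sum_dotProduct, Finset.sum_eq_single A] at h2
    · rw [smul_dotProduct, hw, Finset.inter_self, hF A.1 A.2] at h2
      simpa [choose_nine_four_mod] using h2
    · intro B _ hBA
      have hne : B.1 ≠ A.1 := fun h => hBA (Subtype.ext h)
      have hlt : (B.1 ∩ A.1).card < 9 := by
        rw [← hF B.1 B.2]
        refine Finset.card_lt_card ⟨Finset.inter_subset_left, fun h => hne ?_⟩
        exact Finset.eq_of_subset_of_card_le (fun x hx => (Finset.mem_inter.1 (h hx)).2)
          (by rw [hF A.1 A.2, hF B.1 B.2])
      rw [smul_dotProduct, hw, choose_four_mod hlt (hint _ B.2 _ A.2 hne), smul_zero]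
    · simp
  have h := hlin.fintype_card_le_finrank
  rw [Module.finrank_fintype_fun_eq_card] at h
  have hJ : Fintype.card J = Nat.choose 29 4 := by
    rw [Fintype.card_finset_len, Fintype.card_fin]
  rwa [hJ, Fintype.card_coe] at h

theorem sum_lt_pairs_of_symm {n : ℕ} (g : Fin n → Fin n → ℝ) (hg : ∀ i j, g i j = g j i) :
    2 * ∑ q : {q : Fin n × Fin n // q.1 < q.2}, g q.1.1 q.1.2 =
      ∑ i, ∑ j, g i j - ∑ i, g i i := by
  have h1 : ∑ q : {q : Fin n × Fin n // q.1 < q.2}, g q.1.1 q.1.2 =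
      ∑ i, ∑ j, if i < j then g i j else 0 := by
    rw [← Fintype.sum_prod_type' (fun i j => if i < j then g i j else 0), ← Finset.sum_filter]
    exact (Finset.sum_subtype _ (by simp) (fun q : Fin n × Fin n => g q.1 q.2)).symm
  have h2 : ∑ i, ∑ j, (if j < i then g i j else 0) = ∑ i, ∑ j, if i < j then g i j else 0 := by
    rw [Finset.sum_comm]
    exact Finset.sum_congr rfl fun i _ => Finset.sum_congr rfl fun j _ => by rw [hg]
  have h3 : ∑ i, g i i = ∑ i, ∑ j, if i = j then g i j else 0 := by simp
  rw [h1, two_mul, h3, eq_sub_iff_add_eq]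
  nth_rewrite 2 [← h2]
  simp only [← Finset.sum_add_distrib]
  refine Finset.sum_congr rfl fun i _ => Finset.sum_congr rfl fun j _ => ?_
  rcases lt_trichotomy i j with h | h | h
  · simp [h, h.ne, h.not_gt]
  · simp [h]
  · simp [h, h.ne', h.not_gt]

/-- The weight of the pair `i, j` with respect to `A`: `2` if both lie in `A`, `1` if neither
does, and `0` if `A` separates them. -/
def pairWeight (A : Finset (Fin 29)) (i j : Fin 29) : ℝ :=
  if i ∈ A then (if j ∈ A then 2 else 0) else (if j ∈ A then 0 else 1)

/-- The indicator function of a finset of `Fin 29`, as a real valued function. -/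
def ind (A : Finset (Fin 29)) (i : Fin 29) : ℝ := if i ∈ A then 1 else 0

theorem sum_ind (A : Finset (Fin 29)) : ∑ i, ind A i = A.card := by
  simp [ind]

theorem abs_pairWeight_sub_rpow {p : ℝ} (hp : 0 < p) (A B : Finset (Fin 29)) (i j : Fin 29) :
    |pairWeight A i j - pairWeight B i j| ^ p =
      (2 : ℝ) ^ p * (ind (A ∩ B) i * (ind (A \ B) j + ind (B \ A) j) +
        (ind (A \ B) i + ind (B \ A) i) * ind (A ∩ B) j) +
      (ind (A ∪ B)ᶜ i * (ind (A \ B) j + ind (B \ A) j) +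
        (ind (A \ B) i + ind (B \ A) i) * ind (A ∪ B)ᶜ j) +
      (ind (A \ B) i * ind (A \ B) j + ind (B \ A) i * ind (B \ A) j) := by
  by_cases h1 : i ∈ A <;> by_cases h2 : i ∈ B <;> by_cases h3 : j ∈ A <;> by_cases h4 : j ∈ B <;>
    norm_num [pairWeight, ind, h1, h2, h3, h4, hp.ne']

theorem sum_pairs_rpow {p : ℝ} (hp : 0 < p) (A B : Finset (Fin 29))
    (hA : A.card = 9) (hB : B.card = 9) {h : ℕ} (hAB : (A ∩ B).card + h = 9) :
    ∑ q : {q : Fin 29 × Fin 29 // q.1 < q.2},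
        |pairWeight A q.1.1 q.1.2 - pairWeight B q.1.1 q.1.2| ^ p =
      2 * h * (9 - h) * (2 : ℝ) ^ p + 2 * h * (20 - h) + h * (h - 1) := by
  have hd1 : (A \ B).card = h := by
    have := Finset.card_inter_add_card_sdiff A B
    omega
  have hd2 : (B \ A).card = h := by
    have := Finset.card_inter_add_card_sdiff B A
    rw [Finset.inter_comm] at this
    omega
  have hc : (A ∪ B)ᶜ.card + h = 20 := by
    have h1 := Finset.card_union_add_card_inter A B
    have h2 := Finset.card_add_card_compl (A ∪ B)
    rw [Fintype.card_fin] at h2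
    omega
  have hABr : ((A ∩ B).card : ℝ) = 9 - h := by
    rw [eq_sub_iff_add_eq]
    exact_mod_cast hAB
  have hcr : ((A ∪ B)ᶜ.card : ℝ) = 20 - h := by
    rw [eq_sub_iff_add_eq]
    exact_mod_cast hc
  set x := ind (A ∩ B) with hx
  set y := ind (A \ B) with hy
  set z := ind (B \ A) with hz
  set w := ind (A ∪ B)ᶜ with hw
  have sx : ∑ i, x i = 9 - h := by rw [hx, sum_ind, hABr]
  have sy : ∑ i, y i = h := by rw [hy, sum_ind, hd1]
  have sz : ∑ i, z i = h := by rw [hz, sum_ind, hd2]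
  have sw : ∑ i, w i = 20 - h := by rw [hw, sum_ind, hcr]
  let g : Fin 29 → Fin 29 → ℝ := fun i j =>
    (2 : ℝ) ^ p * (x i * (y j + z j) + (y i + z i) * x j) +
      (w i * (y j + z j) + (y i + z i) * w j) + (y i * y j + z i * z j)
  have hsum : ∑ q : {q : Fin 29 × Fin 29 // q.1 < q.2},
        |pairWeight A q.1.1 q.1.2 - pairWeight B q.1.1 q.1.2| ^ p =
      ∑ q : {q : Fin 29 × Fin 29 // q.1 < q.2}, g q.1.1 q.1.2 :=
    Finset.sum_congr rfl fun q _ => abs_pairWeight_sub_rpow hp A B _ _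
  have hfull : ∑ i, ∑ j, g i j =
      (2 : ℝ) ^ p * ((9 - h) * (h + h) + (h + h) * (9 - h)) +
        ((20 - h) * (h + h) + (h + h) * (20 - h)) + (h * h + h * h) := by
    simp only [g, Finset.sum_add_distrib, ← Finset.mul_sum, ← Finset.sum_mul, sx, sy, sz, sw]
  have hdiag : ∑ i, g i i = h + h := by
    have hgi : ∀ i, g i i = y i + z i := by
      intro i
      simp only [g, hx, hy, hz, hw]
      by_cases h1 : i ∈ A <;> by_cases h2 : i ∈ B <;> simp [ind, h1, h2]
    simp only [hgi, Finset.sum_add_distrib, sy, sz]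
  have h2 := sum_lt_pairs_of_symm g (fun i j => by simp only [g]; ring)
  rw [hfull, hdiag, ← hsum] at h2
  linarith

theorem seven_le_two_rpow {p : ℝ} (hp : 2.81 ≤ p) : (7 : ℝ) ≤ 2 ^ p := by
  have h1 : (7 : ℝ) ≤ 2 ^ (73 / 26 : ℝ) := by
    have h2 : ((2 : ℝ) ^ (73 / 26 : ℝ)) ^ (26 : ℕ) = 2 ^ (73 : ℕ) := by
      rw [← Real.rpow_natCast, ← Real.rpow_mul (by norm_num), ← Real.rpow_natCast]
      norm_num
    refine le_of_pow_le_pow_left₀ (n := 26) (by norm_num) (by positivity) ?_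
    rw [h2]
    norm_num
  exact h1.trans (Real.rpow_le_rpow_of_exponent_le (by norm_num) (by norm_num at hp ⊢; linarith))

theorem pairs_polynomial_le {ρ : ℝ} (hρ : 7 ≤ ρ) {h : ℕ} (hh : h ≤ 9) :
    2 * h * (9 - h) * ρ + 2 * h * (20 - h) + h * (h - 1) ≤ 40 * ρ + 170 := by
  interval_cases h <;> norm_num <;> linarith

theorem card_lt_pairs : Fintype.card {q : Fin 29 × Fin 29 // q.1 < q.2} = 406 := by
  have h := sum_lt_pairs_of_symm (n := 29) (fun _ _ => 1) fun _ _ => rfl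
  simp only [Finset.sum_const, Finset.card_univ, Fintype.card_fin, nsmul_eq_mul,
    Nat.cast_ofNat] at h
  have h2 : (Fintype.card {q : Fin 29 × Fin 29 // q.1 < q.2} : ℝ) = 406 := by linarith
  exact_mod_cast h2

theorem exists_inter_card_eq_four (F : Finset (Finset (Fin 29)))
    (hF : ∀ A ∈ F, A.card = 9) (hcard : Nat.choose 29 4 < F.card) :
    ∃ A ∈ F, ∃ B ∈ F, (A ∩ B).card = 4 := by
  by_contra! hne
  exact hcard.not_ge (card_le_of_forall_inter_ne_four F hF fun A hA B hB _ => hne A hA B hB)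

/-- A numbering of the pairs `i < j` in `Fin 29` by `Fin 406`. -/
noncomputable def pairEquiv : Fin 406 ≃ {q : Fin 29 × Fin 29 // q.1 < q.2} :=
  (Fintype.equivFinOfCardEq card_lt_pairs).symm

/-- The vector of all pair weights with respect to `A`, as a point of `ℓ_p^406`. -/
noncomputable def weightVector (p : ℝ) (A : Finset (Fin 29)) :
    PiLp (ENNReal.ofReal p) (fun _ : Fin 406 => ℝ) :=
  WithLp.toLp _ fun k => pairWeight A (pairEquiv k).1.1 (pairEquiv k).1.2

theorem dist_weightVector {p : ℝ} (hp : 0 < p) [Fact (1 ≤ ENNReal.ofReal p)]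
    (A B : Finset (Fin 29)) (hA : A.card = 9) (hB : B.card = 9) {h : ℕ}
    (hAB : (A ∩ B).card + h = 9) :
    dist (weightVector p A) (weightVector p B) =
      (2 * h * (9 - h) * (2 : ℝ) ^ p + 2 * h * (20 - h) + h * (h - 1)) ^ (1 / p) := by
  rw [PiLp.dist_eq_sum (by rwa [ENNReal.toReal_ofReal hp.le]), ENNReal.toReal_ofReal hp.le,
    ← sum_pairs_rpow hp A B hA hB hAB]
  refine congrArg (· ^ (1 / p)) ?_
  rw [← pairEquiv.sum_comp]
  exact Finset.sum_congr rfl fun k _ => by rw [Real.dist_eq]; rfl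

theorem dist_weightVector_of_inter_card_eq_four {p : ℝ} (hp : 0 < p)
    [Fact (1 ≤ ENNReal.ofReal p)] (A B : Finset (Fin 29)) (hA : A.card = 9) (hB : B.card = 9)
    (hAB : (A ∩ B).card = 4) :
    dist (weightVector p A) (weightVector p B) = (40 * (2 : ℝ) ^ p + 170) ^ (1 / p) := by
  rw [dist_weightVector hp A B hA hB (h := 5) (by omega)]
  refine congrArg (· ^ (1 / p)) ?_
  push_cast
  ring

theorem dist_weightVector_le {p : ℝ} (hp : 2.81 ≤ p) [Fact (1 ≤ ENNReal.ofReal p)]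
    (A B : Finset (Fin 29)) (hA : A.card = 9) (hB : B.card = 9) :
    dist (weightVector p A) (weightVector p B) ≤ (40 * (2 : ℝ) ^ p + 170) ^ (1 / p) := by
  have hp0 : 0 < p := lt_of_lt_of_le (by norm_num) hp
  have hle : (A ∩ B).card ≤ 9 := hA ▸ Finset.card_le_card Finset.inter_subset_left
  obtain ⟨h, hh⟩ := Nat.exists_eq_add_of_le hle
  rw [dist_weightVector hp0 A B hA hB hh.symm]
  refine Real.rpow_le_rpow ?_ (pairs_polynomial_le (seven_le_two_rpow hp) (by omega))
    (by positivity)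
  rw [← sum_pairs_rpow hp0 A B hA hB hh.symm]
  positivity

/-- **Corollary 2.** For all `p ≥ 2.81`, there exists a finite set `S` in `ℓ_p^406` of
positive diameter that cannot be partitioned into fewer than `422` parts each of diameter
strictly smaller than the diameter of `S` (i.e. `b(ℓ_p^406) ≥ 422`). -/
theorem borsuk_lp_406
    (p : ℝ) (hp : 2.81 ≤ p) [Fact (1 ≤ ENNReal.ofReal p)] :
    ∃ S : Set (PiLp (ENNReal.ofReal p) (fun _ : Fin 406 => ℝ)),
      S.Finite ∧ 0 < Metric.diam S ∧
      ∀ (m : ℕ) (P : Fin m → Set (PiLp (ENNReal.ofReal p) (fun _ : Fin 406 => ℝ))),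
        m < 422 →
        S = ⋃ i, P i →
        (∀ i j, i ≠ j → Disjoint (P i) (P j)) →
        ∃ i, Metric.diam S ≤ Metric.diam (P i) := by
  classical
  have hp0 : 0 < p := lt_of_lt_of_le (by norm_num) hp
  set D : ℝ := (40 * (2 : ℝ) ^ p + 170) ^ (1 / p) with hD
  have hDpos : 0 < D := by positivity
  let F : Finset (Finset (Fin 29)) := Finset.powersetCard 9 Finset.univ
  have hF : ∀ A ∈ F, A.card = 9 := fun A hA => (Finset.mem_powersetCard.1 hA).2
  have hFcard : 421 * Nat.choose 29 4 < F.card := by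
    rw [Finset.card_powersetCard, Finset.card_univ, Fintype.card_fin]
    norm_num [Nat.choose]
  let S : Set (PiLp (ENNReal.ofReal p) (fun _ : Fin 406 => ℝ)) :=
    Set.image (weightVector p) F
  have hSfin : S.Finite := F.finite_toSet.image _
  have hdiam : Metric.diam S ≤ D := by
    refine Metric.diam_le_of_forall_dist_le hDpos.le ?_
    rintro _ ⟨A, hA, rfl⟩ _ ⟨B, hB, rfl⟩
    exact dist_weightVector_le hp A B (hF A hA) (hF B hB)
  have hlarge : ∀ T ⊆ S, ∀ G ⊆ F, (∀ A ∈ G, weightVector p A ∈ T) →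
      Nat.choose 29 4 < G.card → D ≤ Metric.diam T := by
    intro T hTS G hGF hGT hG
    obtain ⟨A, hA, B, hB, hAB⟩ :=
      exists_inter_card_eq_four G (fun A hA => hF A (hGF hA)) hG
    rw [hD, ← dist_weightVector_of_inter_card_eq_four hp0 A B (hF A (hGF hA))
      (hF B (hGF hB)) hAB]
    exact Metric.dist_le_diam_of_mem (hSfin.subset hTS).isBounded (hGT A hA) (hGT B hB)
  refine ⟨S, hSfin, hDpos.trans_le (hlarge S subset_rfl F subset_rfl
    (fun A hA => ⟨A, hA, rfl⟩) (by omega)), ?_⟩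
  intro m P hm hS _
  have hmem : ∀ A ∈ F, ∃ i, weightVector p A ∈ P i := fun A hA =>
    Set.mem_iUnion.1 (hS ▸ (⟨A, hA, rfl⟩ : weightVector p A ∈ S))
  let Q : Fin m → Finset (Finset (Fin 29)) := fun i => {A ∈ F | weightVector p A ∈ P i}
  obtain ⟨i, hi⟩ : ∃ i, Nat.choose 29 4 < (Q i).card := by
    by_contra! hsmall
    have hcover : F ⊆ Finset.univ.biUnion Q := by
      intro A hA
      obtain ⟨i, hi⟩ := hmem A hA
      exact Finset.mem_biUnion.2 ⟨i, Finset.mem_univ i, Finset.mem_filter.2 ⟨hA, hi⟩⟩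
    have h1 : F.card ≤ m * Nat.choose 29 4 := by
      refine (Finset.card_le_card hcover).trans (Finset.card_biUnion_le.trans ?_)
      simpa using Finset.sum_le_card_nsmul Finset.univ (fun i => (Q i).card) _
        fun i _ => hsmall i
    have h2 : m * Nat.choose 29 4 ≤ 421 * Nat.choose 29 4 :=
      Nat.mul_le_mul_right _ (by omega)
    exact absurd hFcard (h1.trans h2).not_gt
  refine ⟨i, hdiam.trans (hlarge (P i) ?_ (Q i) (Finset.filter_subset _ _)
    (fun A hA => (Finset.mem_filter.1 hA).2) hi)⟩
  rw [hS]
  exact Set.subset_iUnion P i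
end
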